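/- arXiv:1607.02637 — 3 statements merged into one kernel-verified Lean document; each statement's English description precedes it below -/
import Mathlib

section
/- The rate of maximum flow in a uniform network with dissipation is the same in every stage after the first. Precisely: let ι be a nonempty finite index type, let w : ι → ℕ, let c ≥ 0 and a > 0 be real numbers, and let k ∈ ι satisfy w k ≤ w i for all i. Define C : ℕ → ι → ℝ by C 0 i = c * (w i) and C (n+1) i = C n i − (min over j of C n j) + a * (w i). Then for every n ≥ 1, the minimum over i of C n i equals a * (w k). -/
/-- The rate of maximum flow in a uniform network with dissipation is the same in
every stage after the first: for `n ≥ 1`, the minimum cut capacity at stage `n`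
equals `a * w k`, where `k` indexes the cut of minimum cardinality. -/
theorem uniform_dissipation_max_flow_same
    {ι : Type*} [Fintype ι] [Nonempty ι]
    (w : ι → ℕ) (c a : ℝ) (hc : 0 ≤ c) (ha : 0 < a)
    (k : ι) (hk : ∀ i, w k ≤ w i)
    (C : ℕ → ι → ℝ)
    (hC0 : ∀ i, C 0 i = c * (w i : ℝ))
    (hCs : ∀ n i, C (n + 1) i =
      C n i - Finset.univ.inf' Finset.univ_nonempty (C n) + a * (w i : ℝ)) :
    ∀ n, 1 ≤ n → Finset.univ.inf' Finset.univ_nonempty (C n) = a * (w k : ℝ) := by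
  have hw : ∀ i, (w k : ℝ) ≤ (w i : ℝ) := fun i => by exact_mod_cast hk i
  have hmin : ∀ n i, C n k ≤ C n i := by
    intro n
    induction n with
    | zero =>
      intro i
      rw [hC0, hC0]
      exact mul_le_mul_of_nonneg_left (hw i) hc
    | succ n ih =>
      intro i
      rw [hCs, hCs]
      have h1 := mul_le_mul_of_nonneg_left (hw i) ha.le
      have h2 := ih i
      linarith
  have hinf : ∀ n, Finset.univ.inf' Finset.univ_nonempty (C n) = C n k := by
    intro n
    apply le_antisymm
    · exact Finset.inf'_le _ (Finset.mem_univ k)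
    · exact Finset.le_inf' _ _ (fun i _ => hmin n i)
  intro n hn
  obtain ⟨m, rfl⟩ := Nat.exists_eq_add_of_le' hn
  rw [hinf, hCs, hinf]
  ring
end

section
/- In the proof that the minimum node-cut-set of a uniform network with dissipation is the same in every stage, the stage capacities admit the closed form: with ι a nonempty finite index type, w : ι → ℕ, real numbers c ≥ 0 and a > 0, k ∈ ι with w k ≤ w i for all i, and C : ℕ → ι → ℝ defined by C 0 i = c * (w i) and C (n+1) i = C n i − (min over j of C n j) + a * (w i), one has for every n ≥ 1 and every i: C n i = (c + n * a) * (w i) − (c + (n − 1) * a) * (w k). -/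
/-- Closed form for the stage capacities of a uniform network with dissipation:
for `n ≥ 1`, `C n i = (c + n·a)·(w i) − (c + (n−1)·a)·(w k)`. -/
theorem uniform_dissipation_closed_form
    {ι : Type*} [Fintype ι] [Nonempty ι]
    (w : ι → ℕ) (c a : ℝ) (hc : 0 ≤ c) (ha : 0 < a)
    (k : ι) (hk : ∀ i, w k ≤ w i)
    (C : ℕ → ι → ℝ)
    (hC0 : ∀ i, C 0 i = c * (w i : ℝ))
    (hCs : ∀ n i, C (n + 1) i =
      C n i - Finset.univ.inf' Finset.univ_nonempty (C n) + a * (w i : ℝ)) :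
    ∀ n : ℕ, 1 ≤ n → ∀ i,
      C n i = (c + (n : ℝ) * a) * (w i : ℝ) - (c + ((n : ℝ) - 1) * a) * (w k : ℝ) := by
  have hmin : ∀ n, (∀ i, C n k ≤ C n i) →
      Finset.univ.inf' Finset.univ_nonempty (C n) = C n k := by
    intro n h
    apply le_antisymm
    · exact Finset.inf'_le _ (Finset.mem_univ k)
    · exact Finset.le_inf' _ _ (fun i _ => h i)
  have hk' : ∀ i, (w k : ℝ) ≤ (w i : ℝ) := fun i => by exact_mod_cast hk i
  intro n hn
  induction n, hn using Nat.le_induction with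
  | base =>
    intro i
    have h0 : ∀ i, C 0 k ≤ C 0 i := by
      intro i
      rw [hC0, hC0]
      exact mul_le_mul_of_nonneg_left (hk' i) hc
    have h1 := hCs 0 i
    rw [hmin 0 h0, hC0, hC0] at h1
    rw [zero_add] at h1
    rw [h1]
    push_cast
    ring
  | succ n hn ih =>
    intro i
    have h0 : ∀ i, C n k ≤ C n i := by
      intro i
      rw [ih, ih i]
      have hp : 0 ≤ c + (n : ℝ) * a := by positivity
      have := mul_le_mul_of_nonneg_left (hk' i) hp
      linarith
    rw [hCs, hmin n h0, ih i, ih k]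
    push_cast
    ring
end

section
/- A non-uniform network with dissipation reaches a steady state in which the node-cut-set of strictly minimum cardinality is the minimum node-cut-set and the maximum flow per stage equals a times its cardinality. Precisely: let ι be a nonempty finite index type, let w : ι → ℝ with w i > 0 for all i, let a > 0 be real, let C₀ : ι → ℝ be arbitrary initial capacities, and define C : ℕ → ι → ℝ by C 0 i = C₀ i and C (n+1) i = C n i − (min over j of C n j) + a * (w i). Suppose k ∈ ι satisfies w k < w i for all i ≠ k. Then there exists N such that for all n ≥ N, C n k equals the minimum over i of C n i, and for all n ≥ N + 1, the minimum over i of C n i equals a * (w k). -/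
/-- A non-uniform network with dissipation reaches a steady state: eventually the
cut `M_k` of strictly minimum cardinality is the minimum node-cut-set, and from the
following stage on, the maximum flow per stage equals `a · (w k)`. -/
theorem nonuniform_dissipation_steady_state
    {ι : Type*} [Fintype ι] [Nonempty ι]
    (w : ι → ℝ) (hw : ∀ i, 0 < w i) (a : ℝ) (ha : 0 < a)
    (C₀ : ι → ℝ)
    (C : ℕ → ι → ℝ)
    (hC0 : ∀ i, C 0 i = C₀ i)
    (hCs : ∀ n i, C (n + 1) i =
      C n i - Finset.univ.inf' Finset.univ_nonempty (C n) + a * w i)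
    (k : ι) (hk : ∀ i, i ≠ k → w k < w i) :
    ∃ N : ℕ,
      (∀ n, N ≤ n → C n k = Finset.univ.inf' Finset.univ_nonempty (C n)) ∧
      (∀ n, N + 1 ≤ n → Finset.univ.inf' Finset.univ_nonempty (C n) = a * w k) := by
  have hd : ∀ n i, C n i - C n k = C 0 i - C 0 k + n * (a * (w i - w k)) := by
    intro n i
    induction n with
    | zero => simp
    | succ m ih =>
      rw [hCs m i, hCs m k]
      push_cast
      linarith
  have hev : ∀ i, ∀ᶠ n : ℕ in Filter.atTop, C n k ≤ C n i := by
    intro i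
    by_cases h : i = k
    · subst h
      exact Filter.Eventually.of_forall fun _ => le_rfl
    · have hp : 0 < a * (w i - w k) := mul_pos ha (sub_pos.mpr (hk i h))
      obtain ⟨M, hM⟩ := exists_nat_ge ((C 0 k - C 0 i) / (a * (w i - w k)))
      filter_upwards [Filter.eventually_ge_atTop M] with n hn
      have h1 : (C 0 k - C 0 i) / (a * (w i - w k)) ≤ n :=
        hM.trans (by exact_mod_cast hn)
      rw [div_le_iff₀ hp] at h1
      have := hd n i
      linarith
  obtain ⟨N, hN⟩ := Filter.eventually_atTop.mp (Filter.eventually_all.mpr hev)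
  have hmin : ∀ n, N ≤ n → C n k = Finset.univ.inf' Finset.univ_nonempty (C n) := by
    intro n hn
    exact le_antisymm (Finset.le_inf' _ _ fun i _ => hN n hn i)
      (Finset.inf'_le _ (Finset.mem_univ k))
  refine ⟨N, hmin, ?_⟩
  intro n hn
  obtain ⟨m, rfl⟩ : ∃ m, n = m + 1 := ⟨n - 1, by omega⟩
  rw [← hmin (m + 1) (by omega), hCs m k, ← hmin m (by omega)]
  ring
end
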